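/- Doubling identity for transported quantities: let d ≥ 1, let u : [0,T] × 𝕋^d → ℝ^d be a smooth vector field with div u(t,·) = 0 for every t, let ω : [0,T] × 𝕋^d → ℝ be a smooth solution of ∂_t ω + u·∇ω = 0, and let K : 𝕋^d → ℝ be a C¹ function. Then for every t ∈ [0,T], d/dt ∫_{𝕋^d}∫_{𝕋^d} K(x−y) |ω(t,x) − ω(t,y)|² dx dy = ∫_{𝕋^d}∫_{𝕋^d} ∇K(x−y) · (u(t,x) − u(t,y)) |ω(t,x) − ω(t,y)|² dx dy. -/

import Mathlib

open MeasureTheory ENNReal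

noncomputable section

/-- The fundamental domain `[0,1)^d` of the torus `𝕋^d = ℝ^d/ℤ^d`. -/
def box (d : ℕ) : Set (Fin d → ℝ) := Set.univ.pi fun _ => Set.Ico (0:ℝ) 1

/-- A function on `ℝ^d` is ℤ^d-periodic, i.e. it descends to the torus `𝕋^d`. -/
def IsPeriodic {d : ℕ} {E : Type*} (f : (Fin d → ℝ) → E) : Prop :=
  ∀ (x : Fin d → ℝ) (k : Fin d → ℤ), f (x + fun i => (k i : ℝ)) = f x

/-- Euclidean norm on `ℝ^d`. -/
def eNorm {d : ℕ} (h : Fin d → ℝ) : ℝ := Real.sqrt (∑ i, h i ^ 2)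

/-- Geodesic distance on the torus `𝕋^d`, expressed for (representatives in) `ℝ^d`. -/
def torusDist {d : ℕ} (x y : Fin d → ℝ) : ℝ :=
  ⨅ k : Fin d → ℤ, eNorm (x - y + fun i => (k i : ℝ))
theorem volume_box_lt_top (d : ℕ) : volume (box d) < ⊤ := by
  rw [box, Real.volume_pi_Ico]
  simp

instance isFiniteMeasure_restrict_box (d : ℕ) :
    IsFiniteMeasure ((volume : Measure (Fin d → ℝ)).restrict (box d)) :=
  ⟨by simpa using volume_box_lt_top d⟩

theorem measurableSet_box (d : ℕ) : MeasurableSet (box d) :=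
  MeasurableSet.univ_pi fun _ => measurableSet_Ico

theorem box_subset_Icc (d : ℕ) : box d ⊆ Set.Icc 0 1 := fun _ hx =>
  ⟨fun i => (hx i trivial).1, fun i => (hx i trivial).2.le⟩

theorem integrable_box_prod_of_continuous {d : ℕ} {f : (Fin d → ℝ) × (Fin d → ℝ) → ℝ}
    (hf : Continuous f) :
    Integrable f ((volume.restrict (box d)).prod (volume.restrict (box d))) := by
  rw [Measure.prod_restrict]
  exact (hf.continuousOn.integrableOn_compact (isCompact_Icc.prod isCompact_Icc)).mono_set
    (Set.prod_mono (box_subset_Icc d) (box_subset_Icc d))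

/-- A divergence-free periodic field has zero average along the gradient of a periodic function. -/
theorem integral_box_fderiv_apply_eq_zero {d : ℕ} {v : (Fin d → ℝ) → (Fin d → ℝ)}
    {g : (Fin d → ℝ) → ℝ} (hv : ContDiff ℝ 1 v) (hg : ContDiff ℝ 1 g)
    (hvper : IsPeriodic v) (hgper : IsPeriodic g)
    (hdiv : ∀ x, ∑ i, fderiv ℝ (fun y => v y i) x (Pi.single i 1) = 0) :
    ∫ x in box d, fderiv ℝ g x (v x) = 0 := by
  rcases d with _ | n
  · have h (x) : fderiv ℝ g x (v x) = 0 := by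
      rw [Subsingleton.elim (v x) 0, map_zero]
    simp [h]
  have hvi (i) : ContDiff ℝ 1 (fun y => v y i) := contDiff_pi.1 hv i
  have hder (i x) : HasFDerivAt (fun y => v y i * g y)
      (v x i • fderiv ℝ g x + g x • fderiv ℝ (fun y => v y i) x) x :=
    ((hvi i).differentiable one_ne_zero x).hasFDerivAt.mul
      (hg.differentiable one_ne_zero x).hasFDerivAt
  have hsum (x) : ∑ i, (v x i • fderiv ℝ g x + g x • fderiv ℝ (fun y => v y i) x)
      (Pi.single i 1) = fderiv ℝ g x (v x) := by
    simp only [add_apply, smul_apply, smul_eq_mul,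
      Finset.sum_add_distrib, ← Finset.mul_sum, hdiv, mul_zero, add_zero]
    conv_rhs => rw [pi_eq_sum_univ' (v x), map_sum]
    refine Finset.sum_congr rfl fun i _ => ?_
    rw [map_smul, smul_eq_mul]
  have hcont : Continuous fun x => fderiv ℝ g x (v x) :=
    (hg.continuous_fderiv one_ne_zero).clm_apply hv.continuous
  have key := integral_divergence_of_hasFDerivAt_off_countable' (0 : Fin (n + 1) → ℝ) 1
    zero_le_one (fun i y => v y i * g y)
    (fun i x => v x i • fderiv ℝ g x + g x • fderiv ℝ (fun y => v y i) x) ∅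
    Set.countable_empty (fun i => ((hvi i).continuous.mul hg.continuous).continuousOn)
    (fun x _ i => hder i x)
    (by simpa only [hsum] using hcont.continuousOn.integrableOn_compact isCompact_Icc)
  simp only [hsum] at key
  have hbox : (box (n + 1) : Set (Fin (n + 1) → ℝ)) =ᵐ[volume] Set.Icc 0 1 :=
    Measure.univ_pi_Ico_ae_eq_Icc
  rw [setIntegral_congr_set hbox, key]
  refine Finset.sum_eq_zero fun i _ => ?_
  have hface (x : Fin n → ℝ) : (i.insertNth ((1 : Fin (n + 1) → ℝ) i) x : Fin (n + 1) → ℝ) =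
      (i.insertNth ((0 : Fin (n + 1) → ℝ) i) x : Fin (n + 1) → ℝ) +
        fun j => (((Pi.single i 1 : Fin (n + 1) → ℤ) j : ℤ) : ℝ) := by
    funext j
    refine Fin.succAboveCases i ?_ (fun k => ?_) j
    · simp
    · simp
  simp only [hface, hvper _ _, hgper _ _, sub_self]

theorem stmt14 (d : ℕ) (hd : 1 ≤ d) (T : ℝ) (hT : 0 < T)
    (u : ℝ → (Fin d → ℝ) → (Fin d → ℝ)) (ω : ℝ → (Fin d → ℝ) → ℝ)
    (K : (Fin d → ℝ) → ℝ)
    (hu : ContDiff ℝ (⊤ : ℕ∞) (fun q : ℝ × (Fin d → ℝ) => u q.1 q.2))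
    (hω : ContDiff ℝ (⊤ : ℕ∞) (fun q : ℝ × (Fin d → ℝ) => ω q.1 q.2))
    (huper : ∀ t, IsPeriodic (u t)) (hωper : ∀ t, IsPeriodic (ω t))
    (hdiv : ∀ t x, ∑ i, fderiv ℝ (fun y => u t y i) x (Pi.single i 1) = 0)
    (hK : ContDiff ℝ 1 K) (hKper : IsPeriodic K)
    (htransport : ∀ t x, deriv (fun s => ω s x) t +
      ∑ i, u t x i * fderiv ℝ (ω t) x (Pi.single i 1) = 0)
    (t : ℝ) (ht : t ∈ Set.Icc 0 T) :
    HasDerivAt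
      (fun s => ∫ x in box d, ∫ y in box d, K (x - y) * |ω s x - ω s y| ^ 2 ∂volume ∂volume)
      (∫ x in box d, ∫ y in box d,
        fderiv ℝ K (x - y) (u t x - u t y) * |ω t x - ω t y| ^ 2 ∂volume ∂volume) t := by
  have hut : ContDiff ℝ 1 (u t) :=
    (hu.comp (contDiff_const.prodMk contDiff_id : ContDiff ℝ _ fun x => (t, x))).of_le (by simp)
  have hωt : ContDiff ℝ 1 (ω t) :=
    (hω.comp (contDiff_const.prodMk contDiff_id : ContDiff ℝ _ fun x => (t, x))).of_le (by simp)
  have hω1 : ContDiff ℝ 1 (fun q : ℝ × (Fin d → ℝ) => ω q.1 q.2) := hω.of_le (by simp)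
  set D : ℝ × (Fin d → ℝ) → ℝ :=
    fun q => fderiv ℝ (fun q : ℝ × (Fin d → ℝ) => ω q.1 q.2) q (1, 0) with hD
  have hDcont : Continuous D :=
    (hω1.continuous_fderiv one_ne_zero).clm_apply continuous_const
  have hDder (s x) : HasDerivAt (fun s => ω s x) (D (s, x)) s :=
    (hω1.differentiable one_ne_zero (s, x)).hasFDerivAt.comp_hasDerivAt
      (f := fun s => (s, x)) s ((hasDerivAt_id s).prodMk (hasDerivAt_const s x))
  have hDeq (x) : D (t, x) = -fderiv ℝ (ω t) x (u t x) := by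
    have h := htransport t x
    rw [(hDder t x).deriv] at h
    have h2 : fderiv ℝ (ω t) x (u t x) =
        ∑ i, u t x i * fderiv ℝ (ω t) x (Pi.single i 1) := by
      conv_lhs => rw [pi_eq_sum_univ' (u t x), map_sum]
      refine Finset.sum_congr rfl fun i _ => ?_
      rw [map_smul, smul_eq_mul]
    linarith
  have hωc := hω.continuous
  have hKc := hK.continuous
  have hωtc := hωt.continuous
  have hutc := hut.continuous
  have hK'c := hK.continuous_fderiv one_ne_zero
  have hω'c := hωt.continuous_fderiv one_ne_zero
  simp only [sq_abs]
  set μ := (volume : Measure (Fin d → ℝ)).restrict (box d) with hμ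
  have hωs (s) : Continuous (ω s) := hωc.comp (continuous_const.prodMk continuous_id)
  have hF (s) : Continuous fun p : (Fin d → ℝ) × (Fin d → ℝ) =>
      K (p.1 - p.2) * (ω s p.1 - ω s p.2) ^ 2 := by
    have := hωs s
    fun_prop
  set F' : ℝ → (Fin d → ℝ) × (Fin d → ℝ) → ℝ := fun s p =>
    K (p.1 - p.2) * (2 * (ω s p.1 - ω s p.2) * (D (s, p.1) - D (s, p.2))) with hF'
  have hF'c : Continuous fun q : ℝ × ((Fin d → ℝ) × (Fin d → ℝ)) => F' q.1 q.2 := by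
    have h1 : Continuous fun q : ℝ × ((Fin d → ℝ) × (Fin d → ℝ)) => ω q.1 q.2.1 :=
      hωc.comp (by fun_prop : Continuous fun q : ℝ × ((Fin d → ℝ) × (Fin d → ℝ)) => (q.1, q.2.1))
    have h2 : Continuous fun q : ℝ × ((Fin d → ℝ) × (Fin d → ℝ)) => ω q.1 q.2.2 :=
      hωc.comp (by fun_prop : Continuous fun q : ℝ × ((Fin d → ℝ) × (Fin d → ℝ)) => (q.1, q.2.2))
    simp only [hF']
    fun_prop
  have hF't : Continuous (F' t) :=
    hF'c.comp (continuous_const.prodMk continuous_id)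
  obtain ⟨C, hC⟩ := ((isCompact_Icc (a := t - 1) (b := t + 1)).prod
    ((isCompact_Icc (a := (0 : Fin d → ℝ)) (b := 1)).prod
      (isCompact_Icc (a := (0 : Fin d → ℝ)) (b := 1)))).exists_bound_of_continuousOn
    hF'c.continuousOn
  have hmem : ∀ᵐ p ∂μ.prod μ, p ∈ box d ×ˢ box d := by
    rw [hμ, Measure.prod_restrict]
    exact ae_restrict_mem ((measurableSet_box d).prod (measurableSet_box d))
  have hderiv : HasDerivAt
      (fun s => ∫ p, K (p.1 - p.2) * (ω s p.1 - ω s p.2) ^ 2 ∂μ.prod μ)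
      (∫ p, F' t p ∂μ.prod μ) t := by
    refine (hasDerivAt_integral_of_dominated_loc_of_deriv_le
      (Icc_mem_nhds (sub_one_lt t) (lt_add_one t))
      (Filter.Eventually.of_forall fun s => (hF s).aestronglyMeasurable)
      (integrable_box_prod_of_continuous (hF t)) hF't.aestronglyMeasurable
      (bound := fun _ => C) ?_ (integrable_const C) ?_).2
    · filter_upwards [hmem] with p hp s hs
      exact hC (s, p) ⟨hs, box_subset_Icc d hp.1, box_subset_Icc d hp.2⟩
    · refine Filter.Eventually.of_forall fun p s _ => ?_
      have h := (((hDder s p.1).sub (hDder s p.2)).pow 2).const_mul (K (p.1 - p.2))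
      simpa [hF'] using h
  have hfun : (fun s => ∫ x in box d, ∫ y in box d, K (x - y) * (ω s x - ω s y) ^ 2) =
      fun s => ∫ p, K (p.1 - p.2) * (ω s p.1 - ω s p.2) ^ 2 ∂μ.prod μ := by
    funext s
    exact (integral_prod _ (integrable_box_prod_of_continuous (hF s))).symm
  rw [hfun]
  convert hderiv using 1
  set A : (Fin d → ℝ) × (Fin d → ℝ) → ℝ := fun p =>
    fderiv ℝ K (p.1 - p.2) (u t p.1) * (ω t p.1 - ω t p.2) ^ 2 +
      K (p.1 - p.2) * (2 * (ω t p.1 - ω t p.2) * fderiv ℝ (ω t) p.1 (u t p.1)) with hA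
  set B : (Fin d → ℝ) × (Fin d → ℝ) → ℝ := fun p =>
    -(fderiv ℝ K (p.1 - p.2) (u t p.2) * (ω t p.1 - ω t p.2) ^ 2) -
      K (p.1 - p.2) * (2 * (ω t p.1 - ω t p.2) * fderiv ℝ (ω t) p.2 (u t p.2)) with hB
  set R : (Fin d → ℝ) × (Fin d → ℝ) → ℝ := fun p =>
    fderiv ℝ K (p.1 - p.2) (u t p.1 - u t p.2) * (ω t p.1 - ω t p.2) ^ 2 with hR
  have hAc : Continuous A := by fun_prop
  have hBc : Continuous B := by fun_prop
  have hRc : Continuous R := by fun_prop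
  have hKd (z) : HasFDerivAt K (fderiv ℝ K z) z :=
    (hK.differentiable one_ne_zero z).hasFDerivAt
  have hωd (z) : HasFDerivAt (ω t) (fderiv ℝ (ω t) z) z :=
    (hωt.differentiable one_ne_zero z).hasFDerivAt
  have hper_sub (x y : Fin d → ℝ) (k : Fin d → ℤ) :
      K (x - (y + fun i => (k i : ℝ))) = K (x - y) := by
    rw [← hKper (x - (y + fun i => (k i : ℝ))) k]
    congr 1
    abel
  have hAint : ∫ p, A p ∂μ.prod μ = 0 := by
    rw [integral_prod_symm _ (integrable_box_prod_of_continuous hAc)]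
    refine integral_eq_zero_of_ae (Filter.Eventually.of_forall fun y => ?_)
    rw [Pi.zero_apply]
    have h := integral_box_fderiv_apply_eq_zero (v := u t)
      (g := fun x => K (x - y) * (ω t x - ω t y) ^ 2) hut (by fun_prop) (huper t)
      (fun x k => by
        simp only [hωper t x k, add_sub_right_comm x _ y, hKper (x - y) k]) (hdiv t)
    have hd (x) : fderiv ℝ (fun x => K (x - y) * (ω t x - ω t y) ^ 2) x (u t x) = A (x, y) := by
      have h1 := ((hKd (x - y)).comp x ((hasFDerivAt_id x).sub_const y)).mul
        (((hωd x).sub_const (ω t y)).pow 2)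
      have h2 := h1.fderiv
      simp only [Function.comp_def, id] at h2
      erw [h2]
      simp [hA]
      ring
    simpa only [hd] using h
  have hBint : ∫ p, B p ∂μ.prod μ = 0 := by
    rw [integral_prod _ (integrable_box_prod_of_continuous hBc)]
    refine integral_eq_zero_of_ae (Filter.Eventually.of_forall fun x => ?_)
    rw [Pi.zero_apply]
    have h := integral_box_fderiv_apply_eq_zero (v := u t)
      (g := fun y => K (x - y) * (ω t x - ω t y) ^ 2) hut (by fun_prop) (huper t)
      (fun y k => by simp only [hωper t y k, hper_sub]) (hdiv t)
    have hd (y) : fderiv ℝ (fun y => K (x - y) * (ω t x - ω t y) ^ 2) y (u t y) = B (x, y) := by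
      have h1 := ((hKd (x - y)).comp y ((hasFDerivAt_id y).const_sub x)).mul
        (((hωd y).const_sub (ω t x)).pow 2)
      have h2 := h1.fderiv
      simp only [Function.comp_def] at h2
      erw [h2]
      simp [hB]
      ring
    simpa only [hd] using h
  have hsplit (p) : R p = F' t p + (A p + B p) := by
    simp only [hR, hF', hA, hB, hDeq, map_sub]
    ring
  calc ∫ x in box d, ∫ y in box d, R (x, y)
      = ∫ p, R p ∂μ.prod μ := (integral_prod _ (integrable_box_prod_of_continuous hRc)).symm
    _ = ∫ p, F' t p ∂μ.prod μ := by
      simp only [hsplit]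
      rw [integral_add (g := fun p => A p + B p) (integrable_box_prod_of_continuous hF't)
        ((integrable_box_prod_of_continuous hAc).add (integrable_box_prod_of_continuous hBc)),
        integral_add (integrable_box_prod_of_continuous hAc)
        (integrable_box_prod_of_continuous hBc), hAint, hBint, add_zero, add_zero]
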